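/- arXiv:2108.03708 — 3 statements merged into one kernel-verified Lean document; each statement's English description precedes it below -/
import Mathlib

section
/- Let n : ℕ and let x, y : Fin n → Bool be such that y ≠ x and y is not the bitwise complement of x (so the complementary pairs {x, x̄} and {y, ȳ} are distinct). Then there exists an index i with 1 ≤ i < n such that exactly one of the pairs belongs to the class [i, =]: that is, (x (i−1) = x i) holds if and only if (y (i−1) = y i) fails. In particular, no two distinct bit-complementary pairs belong to the same set of classes [i, =]. -/
/-- If `y ≠ x` and `y` is not the bitwise complement of `x` (so the
complementary pairs `{x, x̄}` and `{y, ȳ}` differ), then there are consecutive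
bit positions `j, i` (with `j + 1 = i`, so `1 ≤ i < n`) on which exactly one of
the pairs lies in the class `[i, =]`: bits `j` and `i` of `x` are equal iff
bits `j` and `i` of `y` are unequal. In particular no two distinct
bit-complementary pairs belong to the same set of classes `[i, =]`. -/
theorem distinct_complementary_pairs_separated (n : ℕ) (x y : Fin n → Bool)
    (hne : y ≠ x) (hcomp : y ≠ fun i => !(x i)) :
    ∃ i j : Fin n, (j : ℕ) + 1 = (i : ℕ) ∧ ((x j = x i) ↔ ¬(y j = y i)) := by
  by_contra hcon
  have key : ∀ k : ℕ, ∀ (hk : k < n) (h0 : 0 < n),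
      (x ⟨k, hk⟩ ^^ y ⟨k, hk⟩) = (x ⟨0, h0⟩ ^^ y ⟨0, h0⟩) := by
    intro k
    induction k with
    | zero => intro _ _; rfl
    | succ k ih =>
      intro hk h0
      have hk' : k < n := by omega
      rw [← ih hk' h0]
      have h : ¬ ((x ⟨k, hk'⟩ = x ⟨k + 1, hk⟩) ↔ ¬ (y ⟨k, hk'⟩ = y ⟨k + 1, hk⟩)) :=
        fun h => hcon ⟨⟨k + 1, hk⟩, ⟨k, hk'⟩, rfl, h⟩
      revert h
      generalize x ⟨k, hk'⟩ = a
      generalize x ⟨k + 1, hk⟩ = b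
      generalize y ⟨k, hk'⟩ = c
      generalize y ⟨k + 1, hk⟩ = d
      revert a b c d
      decide
  obtain ⟨i, hi⟩ := Function.ne_iff.mp hne
  obtain ⟨j, hj⟩ := Function.ne_iff.mp hcomp
  have h0 : 0 < n := i.pos
  have e : (x i ^^ y i) = (x j ^^ y j) :=
    (key i i.isLt h0).trans (key j j.isLt h0).symm
  revert hi hj e
  generalize x i = a
  generalize y i = b
  generalize x j = c
  generalize y j = d
  revert a b c d
  decide
end

section
/- Let n : ℕ. For a pair {x, y} of distinct functions x, y : Fin n → Bool, let S(x,y) = {i | x i = y i} be its agreement set, let v(x,y) be the restriction of x (equivalently y) to S(x,y), and let j₀ < j₁ < ⋯ < j_{k−1} be the increasing enumeration of the positions outside S(x,y); define the relation pattern r(x,y) : Fin (k−1) → Bool by r(x,y) t = decide (x j_t = x j_{t+1}). Then the map {x, y} ↦ (S(x,y), v(x,y), r(x,y)) is injective on unordered pairs of distinct n-bit integers: if two such pairs have the same agreement set, the same shared values on it, and the same relation pattern on consecutive free positions, then the pairs are equal. -/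
/-- The map sending an unordered pair `{x, y}` of distinct `n`-bit integers to
its agreement set `S(x,y) = {i | x i = y i}`, the shared values on it, and the
relation pattern `r(x,y)` on consecutive free positions (positions outside the
agreement set, enumerated in increasing order) is injective: two pairs with the
same agreement set, the same shared values, and the same relation pattern are
equal (as unordered pairs). -/
theorem pair_determined_by_syndrome_and_relations (n : ℕ)
    (x y x' y' : Fin n → Bool) (hxy : x ≠ y) (hxy' : x' ≠ y')
    (hS : ∀ i, x i = y i ↔ x' i = y' i)
    (hv : ∀ i, x i = y i → x i = x' i)
    (hr : ∀ t t' : Fin (Finset.univ.filter (fun i => x i ≠ y i)).card,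
      (t' : ℕ) = (t : ℕ) + 1 →
      ((x ((Finset.univ.filter (fun i => x i ≠ y i)).orderEmbOfFin rfl t) =
          x ((Finset.univ.filter (fun i => x i ≠ y i)).orderEmbOfFin rfl t')) ↔
        (x' ((Finset.univ.filter (fun i => x i ≠ y i)).orderEmbOfFin rfl t) =
          x' ((Finset.univ.filter (fun i => x i ≠ y i)).orderEmbOfFin rfl t')))) :
    (x' = x ∧ y' = y) ∨ (x' = y ∧ y' = x) := by
  obtain ⟨i₀, hi₀⟩ := Function.ne_iff.mp hxy
  have hmem : ∀ i, x i ≠ y i → ∃ t,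
      (Finset.univ.filter (fun i => x i ≠ y i)).orderEmbOfFin rfl t = i := by
    intro i hi
    have h := Finset.range_orderEmbOfFin (Finset.univ.filter (fun i => x i ≠ y i)) rfl
    have h2 : i ∈ Set.range ((Finset.univ.filter (fun i => x i ≠ y i)).orderEmbOfFin rfl) := by
      rw [h]; simpa using hi
    exact h2
  generalize (Finset.univ.filter (fun i => x i ≠ y i)).orderEmbOfFin rfl = e at hr hmem
  generalize (Finset.univ.filter (fun i => x i ≠ y i)).card = k at e hr hmem
  obtain ⟨t₀, -⟩ := hmem i₀ hi₀
  have hk : 0 < k := t₀.pos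
  have key : ∀ m (hm : m < k),
      (x (e ⟨m, hm⟩) = x' (e ⟨m, hm⟩) ↔ x (e ⟨0, hk⟩) = x' (e ⟨0, hk⟩)) := by
    intro m
    induction m with
    | zero => intro _; rfl
    | succ m ih =>
      intro hm
      have h1 := ih (by omega)
      have h2 := hr ⟨m, by omega⟩ ⟨m + 1, hm⟩ rfl
      rw [← h1]
      revert h2
      generalize x (e ⟨m, _⟩) = a
      generalize x (e ⟨m + 1, _⟩) = b
      generalize x' (e ⟨m, _⟩) = c
      generalize x' (e ⟨m + 1, _⟩) = d
      revert a b c d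
      decide
  by_cases h0 : x (e ⟨0, hk⟩) = x' (e ⟨0, hk⟩)
  · left
    have hx : ∀ i, x' i = x i := by
      intro i
      by_cases hi : x i = y i
      · exact (hv i hi).symm
      · obtain ⟨t, rfl⟩ := hmem i hi
        exact ((key t t.2).mpr h0).symm
    refine ⟨funext hx, funext fun i => ?_⟩
    have h1 := hx i
    have h2 := hS i
    revert h1 h2
    generalize x i = a
    generalize y i = b
    generalize x' i = c
    generalize y' i = d
    revert a b c d
    decide
  · right
    have hx : ∀ i, x' i = y i := by
      intro i
      by_cases hi : x i = y i
      · rw [← hv i hi, hi]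
      · obtain ⟨t, rfl⟩ := hmem i hi
        have h3 : ¬ x (e t) = x' (e t) := fun h => h0 ((key t t.2).mp h)
        revert h3 hi
        generalize x (e t) = a
        generalize y (e t) = b
        generalize x' (e t) = c
        revert a b c
        decide
    refine ⟨funext hx, funext fun i => ?_⟩
    have h1 := hx i
    have h2 := hS i
    revert h1 h2
    generalize x i = a
    generalize y i = b
    generalize x' i = c
    generalize y' i = d
    revert a b c d
    decide
end

section
/- The CNOT gate can be expressed via one Mølmer–Sørensen gate and single-qubit rotations up to a global phase: there exists a complex number c with ‖c‖ = 1 such that CNOT = c • ((Ry(π/2) ⊗ₖ I₂) * (Rx(−π/2) ⊗ₖ Rx(π/2)) * XX(π/2) * (Ry(−π/2) ⊗ₖ I₂)). -/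
open Matrix

/-- The 2×2 Pauli-X matrix. -/
def PauliX : Matrix (Fin 2) (Fin 2) ℂ := !![0, 1; 1, 0]

/-- The 2×2 Pauli-Y matrix. -/
def PauliY : Matrix (Fin 2) (Fin 2) ℂ := !![0, -Complex.I; Complex.I, 0]

/-- Kronecker product of two 2×2 matrices, reindexed as a 4×4 matrix
(first factor is the control/high-order qubit). -/
def kron4 (A B : Matrix (Fin 2) (Fin 2) ℂ) : Matrix (Fin 4) (Fin 4) ℂ :=
  Matrix.reindex finProdFinEquiv finProdFinEquiv (Matrix.kroneckerMap (· * ·) A B)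

/-- Single-qubit rotation about the X axis: `Rx(θ) = exp(-iθX/2)`. -/
noncomputable def Rx (θ : ℝ) : Matrix (Fin 2) (Fin 2) ℂ :=
  (Real.cos (θ / 2) : ℂ) • (1 : Matrix (Fin 2) (Fin 2) ℂ) -
    (Complex.I * Real.sin (θ / 2)) • PauliX

/-- Single-qubit rotation about the Y axis: `Ry(θ) = exp(-iθY/2)`. -/
noncomputable def Ry (θ : ℝ) : Matrix (Fin 2) (Fin 2) ℂ :=
  (Real.cos (θ / 2) : ℂ) • (1 : Matrix (Fin 2) (Fin 2) ℂ) -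
    (Complex.I * Real.sin (θ / 2)) • PauliY

/-- The Mølmer–Sørensen gate `XX(θ) = exp(-iθ (X ⊗ X)/2)`. -/
noncomputable def MS (θ : ℝ) : Matrix (Fin 4) (Fin 4) ℂ :=
  (Real.cos (θ / 2) : ℂ) • (1 : Matrix (Fin 4) (Fin 4) ℂ) -
    (Complex.I * Real.sin (θ / 2)) • kron4 PauliX PauliX

/-- The controlled-NOT gate (first qubit is the control). -/
def CNOT : Matrix (Fin 4) (Fin 4) ℂ :=
  !![1, 0, 0, 0; 0, 1, 0, 0; 0, 0, 0, 1; 0, 0, 1, 0]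

theorem kron4_explicit (A B : Matrix (Fin 2) (Fin 2) ℂ) : kron4 A B =
    !![A 0 0 * B 0 0, A 0 0 * B 0 1, A 0 1 * B 0 0, A 0 1 * B 0 1;
       A 0 0 * B 1 0, A 0 0 * B 1 1, A 0 1 * B 1 0, A 0 1 * B 1 1;
       A 1 0 * B 0 0, A 1 0 * B 0 1, A 1 1 * B 0 0, A 1 1 * B 0 1;
       A 1 0 * B 1 0, A 1 0 * B 1 1, A 1 1 * B 1 0, A 1 1 * B 1 1] := by
  ext i j
  fin_cases i <;> fin_cases j <;> rfl

set_option maxHeartbeats 4000000 in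
/-- CNOT can be expressed via one Mølmer–Sørensen gate and single-qubit
rotations up to a global phase:
`CNOT = c • (Ry(π/2) ⊗ I)(Rx(-π/2) ⊗ Rx(π/2)) XX(π/2) (Ry(-π/2) ⊗ I)`
for some unit-norm complex number `c`. -/
theorem CNOT_eq_MS_conjugated :
    ∃ c : ℂ, ‖c‖ = 1 ∧
      CNOT = c • (kron4 (Ry (Real.pi / 2)) 1 *
        kron4 (Rx (-(Real.pi / 2))) (Rx (Real.pi / 2)) *
        MS (Real.pi / 2) *
        kron4 (Ry (-(Real.pi / 2))) 1) := by
  obtain ⟨s, hs⟩ : ∃ s : ℝ, s = √2 / 2 := ⟨_, rfl⟩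
  have hs2 : s ^ 2 = 1 / 2 := by
    rw [hs, div_pow, Real.sq_sqrt (by norm_num)]; norm_num
  have hc : Real.cos (Real.pi / 2 / 2) = s := by
    rw [hs, ← Real.cos_pi_div_four]; congr 1; ring
  have hn : Real.sin (Real.pi / 2 / 2) = s := by
    rw [hs, ← Real.sin_pi_div_four]; congr 1; ring
  have hsc : (s : ℂ) ^ 2 = 1 / 2 := by
    have := congrArg (fun x : ℝ => (x : ℂ)) hs2
    push_cast at this
    exact this
  have h6 : (s : ℂ) ^ 6 = 1 / 8 := by
    rw [show (s : ℂ) ^ 6 = ((s : ℂ) ^ 2) ^ 3 by ring, hsc]; norm_num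
  have hI : Complex.I ^ 2 = -1 := Complex.I_sq
  refine ⟨s + s * Complex.I, ?_, ?_⟩
  · rw [Complex.norm_add_mul_I, ← two_mul, hs2]; norm_num
  · have hRy : Ry (Real.pi / 2) = !![(s : ℂ), -s; s, s] := by
      ext i j
      fin_cases i <;> fin_cases j <;> simp [Ry, PauliY, hc, hn, -Complex.ofReal_cos, -Complex.ofReal_sin] <;> grind
    have hRy' : Ry (-(Real.pi / 2)) = !![(s : ℂ), s; -s, s] := by
      ext i j
      fin_cases i <;> fin_cases j <;> simp [Ry, PauliY, hc, hn, neg_div, -Complex.ofReal_cos, -Complex.ofReal_sin] <;> grind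
    have hRx : Rx (Real.pi / 2) = !![(s : ℂ), -(Complex.I * s); -(Complex.I * s), s] := by
      ext i j
      fin_cases i <;> fin_cases j <;> simp [Rx, PauliX, hc, hn, -Complex.ofReal_cos, -Complex.ofReal_sin]
    have hRx' : Rx (-(Real.pi / 2)) = !![(s : ℂ), Complex.I * s; Complex.I * s, s] := by
      ext i j
      fin_cases i <;> fin_cases j <;> simp [Rx, PauliX, hc, hn, neg_div, -Complex.ofReal_cos, -Complex.ofReal_sin]
    have hMS : MS (Real.pi / 2) = !![(s : ℂ), 0, 0, -(Complex.I * s); 0, s, -(Complex.I * s), 0;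
        0, -(Complex.I * s), s, 0; -(Complex.I * s), 0, 0, s] := by
      rw [MS, hc, hn, kron4_explicit]
      ext i j
      fin_cases i <;> fin_cases j <;> simp [PauliX]
    rw [hRy, hRy', hRx, hRx', hMS]
    simp only [kron4_explicit]
    ext i j
    fin_cases i <;> fin_cases j <;>
      simp [CNOT] <;> grind
end
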